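/- (Key renormalization estimate.) Let d ≥ 3. There exist positive constants c₁, c₂ depending only on d, a constant c = c(d), and thresholds c(L₀) and c(L₀,u₀) with the following property. Suppose L₀ ≥ c, u₀ ≥ c(L₀), and r is an integer with r ≥ c(L₀,u₀); define u_n = u₀·Π_{0≤n'<n}(1 + c₁·ℓ_{n'}^{−(d−2)})^{r+1} for n ≥ 0, and assume that for every n there exists a vacant-set law Q_{u_n} at level u_n. Then c₂·ℓ_n^{2(d−1)}·p_n(u_n) ≤ L_n^{−1} for all n ≥ 0. -/

import Mathlib

open MeasureTheory
open scoped ENNReal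

abbrev Zd (d : ℕ) := Fin d → ℤ

/-- Nearest-neighbor adjacency on `ℤ^d`. -/
def adj {d : ℕ} (x y : Zd d) : Prop := (∑ i, (x i - y i).natAbs) = 1

instance {d : ℕ} (x y : Zd d) : Decidable (adj x y) := by
  unfold adj; infer_instance

/-- `P` is the family of laws of simple random walk on `ℤ^d`, characterized by its
finite-dimensional (cylinder) distributions. -/
def IsSRW (d : ℕ) (P : Zd d → Measure (ℕ → Zd d)) : Prop :=
  (∀ x, IsProbabilityMeasure (P x)) ∧
  ∀ (x : Zd d) (N : ℕ) (γ : ℕ → Zd d), γ 0 = x →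
    P x {w | ∀ k ≤ N, w k = γ k} =
      if ∀ k < N, adj (γ (k + 1)) (γ k) then ((2 * d : ℝ≥0∞))⁻¹ ^ N else 0

/-- The event `{H̃_K = ∞}`. -/
def escSet (d : ℕ) (K : Finset (Zd d)) : Set (ℕ → Zd d) :=
  {ω | ∀ n : ℕ, 1 ≤ n → ω n ∉ K}

/-- The equilibrium measure `e_K`. -/
noncomputable def eqm (d : ℕ) (P : Zd d → Measure (ℕ → Zd d)) (K : Finset (Zd d))
    (x : Zd d) : ℝ≥0∞ :=
  if x ∈ K then P x (escSet d K) else 0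

/-- The capacity `cap(K) = Σ_x e_K(x)`. -/
noncomputable def capa (d : ℕ) (P : Zd d → Measure (ℕ → Zd d)) (K : Finset (Zd d)) : ℝ≥0∞ :=
  ∑ x ∈ K, eqm d P K x

/-- `Q` is a vacant-set law at level `u`:
`Q[Y_z = 1 for z ∈ K] = exp(−u·cap(K))` for every finite `K`. -/
def IsVacantLaw (d : ℕ) (P : Zd d → Measure (ℕ → Zd d)) (u : ℝ)
    (Q : Measure (Zd d → Bool)) : Prop :=
  IsProbabilityMeasure Q ∧
  ∀ K : Finset (Zd d),
    Q {ω | ∀ z ∈ K, ω z = true} = ENNReal.ofReal (Real.exp (-(u * (capa d P K).toReal)))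

/-- The length scales `L_n` of Section 3: `L_{n+1} = ℓ_n L_n`, `ℓ_n = 100⌊L_n^a⌋`,
`a = 1/(100d)`. -/
noncomputable def Lscale (d L0 : ℕ) : ℕ → ℕ
  | 0 => L0
  | n + 1 => (100 * ⌊(Lscale d L0 n : ℝ) ^ ((1 : ℝ) / (100 * d))⌋₊) * Lscale d L0 n

/-- `ℓ_n = 100⌊L_n^a⌋`. -/
noncomputable def ellScale (d L0 n : ℕ) : ℕ :=
  100 * ⌊(Lscale d L0 n : ℝ) ^ ((1 : ℝ) / (100 * d))⌋₊

/-- The box `C_{n,i} = i L_n + [0,L_n)^d`. -/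
def boxC (d L0 n : ℕ) (i : Zd d) : Set (Zd d) :=
  {z | ∀ j, i j * (Lscale d L0 n : ℤ) ≤ z j ∧ z j < (i j + 1) * (Lscale d L0 n : ℤ)}

/-- `C̃_{n,i}`, the union of `C_{n,i}` and its `*`-neighboring boxes of level `n`. -/
def boxCtil (d L0 n : ℕ) (i : Zd d) : Set (Zd d) :=
  {z | ∀ j, (i j - 1) * (Lscale d L0 n : ℤ) ≤ z j ∧ z j < (i j + 2) * (Lscale d L0 n : ℤ)}

/-- `S̃_{n,i}`, the interior boundary of `C̃_{n,i}`. -/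
def boxStil (d L0 n : ℕ) (i : Zd d) : Set (Zd d) :=
  {z ∈ boxCtil d L0 n i | ∃ y : Zd d, adj y z ∧ y ∉ boxCtil d L0 n i}

/-- The crossing event `A^u_{n,i}`: there is a nearest-neighbor path of vacant sites
(`Y = 1`) inside `C̃_{n,i}` from `C_{n,i}` to `S̃_{n,i}`. -/
def crossEvent (d L0 n : ℕ) (i : Zd d) : Set (Zd d → Bool) :=
  {ω | ∃ (len : ℕ) (γ : ℕ → Zd d),
      γ 0 ∈ boxC d L0 n i ∧ γ len ∈ boxStil d L0 n i ∧
      (∀ k ≤ len, γ k ∈ boxCtil d L0 n i ∧ ω (γ k) = true) ∧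
      ∀ k < len, adj (γ (k + 1)) (γ k)}


namespace RK

def stp {d : ℕ} (p : Fin d × Bool) : Zd d := Pi.single p.1 (if p.2 then 1 else -1)

lemma stp_inj {d : ℕ} : Function.Injective (stp (d := d)) := by
  rintro ⟨i, b⟩ ⟨j, c⟩ h
  have h1 := congrFun h i
  have h2 := congrFun h j
  by_cases hij : i = j
  · subst hij
    simp only [stp, Pi.single_eq_same] at h1
    cases b <;> cases c <;> simp_all
  · exfalso
    simp only [stp, Pi.single_eq_same, Pi.single_apply, hij] at h1
    cases b <;> simp at h1

lemma adj_iff {d : ℕ} (y x : Zd d) : adj y x ↔ ∃ p, y = x + stp p := by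
  constructor
  · intro h
    unfold adj at h
    have hne : ∃ i, (y i - x i).natAbs ≠ 0 := by
      by_contra hcon
      push Not at hcon
      simp [hcon] at h
    obtain ⟨i, hi⟩ := hne
    rw [← Finset.add_sum_erase _ _ (Finset.mem_univ i)] at h
    have h0 : ∑ j ∈ Finset.univ.erase i, (y j - x j).natAbs = 0 := by omega
    rw [Finset.sum_eq_zero_iff] at h0
    have h1 : (y i - x i).natAbs = 1 := by omega
    refine ⟨(i, decide (y i - x i = 1)), ?_⟩
    funext j
    by_cases hj : j = i
    · subst hj
      simp only [stp, Pi.add_apply, Pi.single_eq_same, decide_eq_true_eq]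
      split_ifs <;> omega
    · have := h0 j (by simp [hj])
      simp only [stp, Pi.add_apply, Pi.single_apply, hj, if_false]
      omega
  · rintro ⟨⟨i, b⟩, rfl⟩
    unfold adj
    rw [Finset.sum_eq_single i]
    · cases b <;> simp [stp]
    · intro j _ hj
      simp [stp, Pi.single_apply, hj]
    · simp

def cyl {d : ℕ} (N : ℕ) (γ : ℕ → Zd d) : Set (ℕ → Zd d) := {w | ∀ k ≤ N, w k = γ k}

def cyls (d : ℕ) : Set (Set (ℕ → Zd d)) := {s | ∃ N γ, s = cyl N γ}

lemma meas_cyl {d : ℕ} (N : ℕ) (γ : ℕ → Zd d) : MeasurableSet (cyl N γ) := by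
  have : cyl N γ = ⋂ k, ⋂ (_ : k ≤ N), (fun w : ℕ → Zd d => w k) ⁻¹' {γ k} := by
    ext w; simp [cyl]
  rw [this]
  exact MeasurableSet.iInter fun k => MeasurableSet.iInter fun _ =>
    (measurable_pi_apply k) (measurableSet_singleton _)

lemma isPi (d : ℕ) : IsPiSystem (cyls d) := by
  rintro _ ⟨N, γ, rfl⟩ _ ⟨M, η, rfl⟩ ⟨w, hw1, hw2⟩
  refine ⟨max N M, w, ?_⟩
  ext v
  constructor
  · rintro ⟨h1, h2⟩ k hk
    rcases le_max_iff.1 hk with h | h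
    · rw [h1 k h, hw1 k h]
    · rw [h2 k h, hw2 k h]
  · intro h
    exact ⟨fun k hk => by rw [h k (le_max_of_le_left hk), hw1 k hk],
      fun k hk => by rw [h k (le_max_of_le_right hk), hw2 k hk]⟩

lemma gen (d : ℕ) : (inferInstance : MeasurableSpace (ℕ → Zd d)) =
    MeasurableSpace.generateFrom (cyls d) := by
  apply le_antisymm
  · refine iSup_le fun k => ?_
    rintro s ⟨t, -, rfl⟩
    have : (fun w : ℕ → Zd d => w k) ⁻¹' t =
        ⋃ γ : Fin (k+1) → Zd d, ⋃ (_ : γ (Fin.last k) ∈ t),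
          cyl k (fun j => if h : j < k + 1 then γ ⟨j, h⟩ else 0) := by
      ext w
      simp only [Set.mem_preimage, Set.mem_iUnion]
      constructor
      · intro hw
        refine ⟨fun j => w j, by simpa using hw, ?_⟩
        intro j hj
        simp [Nat.lt_succ_of_le hj]
      · rintro ⟨γ, hγ, hw⟩
        have := hw k le_rfl
        simp only [Nat.lt_succ_self, dif_pos] at this
        rw [this]; exact hγ
    rw [this]
    refine MeasurableSet.iUnion fun γ => MeasurableSet.iUnion fun _ => ?_
    exact MeasurableSpace.measurableSet_generateFrom ⟨_, _, rfl⟩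
  · apply MeasurableSpace.generateFrom_le
    rintro _ ⟨N, γ, rfl⟩
    exact meas_cyl N γ

def shift {d : ℕ} (w : ℕ → Zd d) : ℕ → Zd d := fun k => w (k+1)

lemma meas_shift {d : ℕ} : Measurable (shift (d := d)) :=
  measurable_pi_lambda _ fun k => measurable_pi_apply (k+1)

variable {d : ℕ} {P : Zd d → Measure (ℕ → Zd d)}

lemma start (hP : IsSRW d P) (x : Zd d) : ∀ᵐ w ∂(P x), w 0 = x := by
  have := hP.1 x
  have h := hP.2 x 0 (fun _ => x) rfl
  simp only [Nat.le_zero, forall_eq, Nat.not_lt_zero, false_imp_iff, implies_true, if_true,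
    pow_zero] at h
  exact (mem_ae_iff_prob_eq_one (by
    exact (measurable_pi_apply (X := fun _ : ℕ => Zd d) 0) (measurableSet_singleton x))).2 h

lemma cyl_ne (hP : IsSRW d P) (x : Zd d) (N : ℕ) (γ : ℕ → Zd d) (h : γ 0 ≠ x) :
    P x (cyl N γ) = 0 := by
  refine measure_mono_null ?_ (ae_iff.1 (start hP x))
  intro w hw h2
  exact h (by rw [← hw 0 (Nat.zero_le _), h2])

lemma markov (hP : IsSRW d P) (hd : 3 ≤ d) (x : Zd d) (A : Set (ℕ → Zd d))
    (hA : MeasurableSet A) :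
    P x (shift ⁻¹' A) = ∑ p, (2 * d : ℝ≥0∞)⁻¹ * P (x + stp p) A := by
  have := hP.1
  have hd0 : (2 * d : ℝ≥0∞) ≠ 0 := by
    simp; omega
  have hdt : (2 * d : ℝ≥0∞) ≠ ⊤ := ENNReal.mul_ne_top (by simp) (by simp)
  have key : (P x).map shift = ∑ p, (2 * d : ℝ≥0∞)⁻¹ • P (x + stp p) := by
    have : IsProbabilityMeasure ((P x).map shift) :=
      Measure.isProbabilityMeasure_map meas_shift.aemeasurable
    refine ext_of_generate_finite (cyls d) (gen d) (isPi d) ?_ ?_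
    · rintro _ ⟨N, γ, rfl⟩
      rw [Measure.map_apply meas_shift (meas_cyl N γ)]
      simp only [Measure.coe_finsetSum, Finset.sum_apply, Measure.smul_apply, smul_eq_mul]
      have e1 : P x (shift ⁻¹' cyl N γ) =
          P x {w | ∀ k ≤ N + 1, w k = (fun k => Nat.casesOn k x γ : ℕ → Zd d) k} := by
        apply measure_congr
        filter_upwards [start hP x] with w hw
        apply propext
        constructor
        · intro h k hk
          cases k with
          | zero => exact hw
          | succ k => exact h k (by omega)
        · intro h k hk
          exact h (k+1) (by omega)
      rw [e1, hP.2 x (N+1) _ rfl]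
      by_cases hadj : adj (γ 0) x
      · obtain ⟨p, hp⟩ := (adj_iff _ _).1 hadj
        rw [Finset.sum_eq_single p]
        · have := hP.2 (x + stp p) N γ hp
          rw [show P (x + stp p) (cyl N γ) = _ from this]
          have e2 : (∀ k < N + 1, adj ((fun k => Nat.casesOn k x γ : ℕ → Zd d) (k+1))
              ((fun k => Nat.casesOn k x γ : ℕ → Zd d) k)) ↔ ∀ k < N, adj (γ (k+1)) (γ k) := by
            constructor
            · intro h k hk
              exact h (k+1) (by omega)
            · intro h k hk
              cases k with
              | zero => exact hadj
              | succ k => exact h k (by omega)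
          simp only [e2]
          split_ifs
          · rw [pow_succ, mul_comm]
          · simp
        · intro q _ hq
          rw [cyl_ne hP, mul_zero]
          intro h
          apply hq
          rw [hp] at h
          exact (stp_inj (add_left_cancel h)).symm
        · simp
      · rw [if_neg, Finset.sum_eq_zero]
        · intro q _
          rw [cyl_ne hP, mul_zero]
          intro h
          exact hadj ((adj_iff _ _).2 ⟨q, h⟩)
        · intro h
          exact hadj (h 0 (by omega))
    · simp only [measure_univ, Measure.coe_finsetSum, Finset.sum_apply, Measure.smul_apply,
        smul_eq_mul, mul_one, Finset.sum_const, Finset.card_univ, Fintype.card_prod,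
        Fintype.card_fin, Fintype.card_bool, nsmul_eq_mul]
      push_cast
      rw [mul_comm (d : ℝ≥0∞) 2, ENNReal.mul_inv_cancel hd0 hdt]
  rw [← Measure.map_apply meas_shift hA, key]
  simp

noncomputable def sq (x : Zd d) : ℝ := ∑ i, (x i : ℝ)^2

noncomputable def hf (x : Zd d) : ℝ := (sq x + 99) ^ (-(1/4) : ℝ)

lemma sq_nonneg' (x : Zd d) : 0 ≤ sq x := Finset.sum_nonneg fun _ _ => _root_.sq_nonneg _

lemma hf_pos (x : Zd d) : 0 < hf x := Real.rpow_pos_of_pos (by have := sq_nonneg' x; linarith) _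

lemma sq_stp (x : Zd d) (j : Fin d) (b : Bool) :
    sq (x + stp (j, b)) = sq x + 2 * (if b then 1 else -1) * x j + 1 := by
  unfold sq
  rw [← Finset.add_sum_erase _ _ (Finset.mem_univ j),
    ← Finset.add_sum_erase _ (fun i => (x i : ℝ)^2) (Finset.mem_univ j)]
  have : ∑ i ∈ Finset.univ.erase j, (((x + stp (j, b)) i : ℤ) : ℝ)^2
      = ∑ i ∈ Finset.univ.erase j, (x i : ℝ)^2 := by
    apply Finset.sum_congr rfl
    intro i hi
    have : i ≠ j := (Finset.mem_erase.1 hi).1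
    simp [stp, Pi.single_apply, this]
  rw [this]
  cases b <;> simp [stp] <;> ring

lemma q_bound (t : ℝ) (ht : t^2 ≤ 1/100) :
    (1 + t) ^ (-(1/4) : ℝ) ≤ 1 - t/4 + 3*t^2/16 := by
  have h1 : -(1/10) ≤ t := by nlinarith
  have h2 : t ≤ 1/10 := by nlinarith
  have hq : 0 < 1 - t/4 + 3*t^2/16 := by nlinarith
  have h4 : (1 + t)⁻¹ ≤ (1 - t/4 + 3*t^2/16)^4 := by
    rw [inv_le_iff_one_le_mul₀ (by linarith)]
    have hor : ∀ c v : ℝ, |c| ≤ 9/10 → |v| ≤ 1 → |c + t * v| ≤ 1 := by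
      intro c v hc hv
      have ht' : |t| ≤ 1/10 := abs_le.2 ⟨h1, h2⟩
      calc |c + t * v| ≤ |c| + |t * v| := abs_add_le _ _
        _ = |c| + |t| * |v| := by rw [abs_mul]
        _ ≤ 9/10 + 1/10 * 1 := by gcongr
        _ = 1 := by norm_num
    have k1 := hor (-351/65536) (81/65536) (by rw [abs_le]; norm_num) (by rw [abs_le]; norm_num)
    have k2 := hor (135/4096) _ (by rw [abs_le]; norm_num) k1
    have k3 := hor (-159/2048) _ (by rw [abs_le]; norm_num) k2
    have k4 := hor (61/256) _ (by rw [abs_le]; norm_num) k3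
    have k5 := hor (-69/256) _ (by rw [abs_le]; norm_num) k4
    set V := -69/256 + t * (61/256 + t * (-159/2048 + t * (135/4096 +
      t * (-351/65536 + t * (81/65536))))) with hV
    have e : (1 - t/4 + 3*t^2/16)^4 * (1+t) = 1 + t^2 * (1/8 + t/2 + t^2 * V) := by
      rw [hV]; ring
    have hVl := (abs_le.1 k5).1
    have : 0 ≤ 1/8 + t/2 + t^2 * V := by nlinarith [_root_.sq_nonneg t]
    rw [e]
    nlinarith [mul_nonneg (_root_.sq_nonneg t) this]
  have h5 : (1+t) ^ (-(1/4) : ℝ) = ((1+t)⁻¹) ^ ((1/4) : ℝ) := by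
    rw [Real.rpow_neg (by linarith), Real.inv_rpow (by linarith)]
  rw [h5]
  calc ((1+t)⁻¹) ^ ((1/4) : ℝ) ≤ ((1 - t/4 + 3*t^2/16)^4) ^ ((1/4) : ℝ) :=
        Real.rpow_le_rpow (by have : 0 < 1 + t := by linarith
                              positivity) h4 (by norm_num)
    _ = 1 - t/4 + 3*t^2/16 := by
        rw [← Real.rpow_natCast, ← Real.rpow_mul hq.le]; norm_num

lemma r_bound (y : ℝ) (h0 : 0 ≤ y) (h1 : y ≤ 1/100) :
    1 + y/4 ≤ (1 - y) ^ (-(1/4) : ℝ) := by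
  have h4 : (1 + y/4)^4 ≤ (1-y)⁻¹ := by
    rw [le_inv_comm₀ (by positivity) (by linarith), le_inv_comm₀ (by linarith) (by positivity)]
    rw [← one_div, le_div_iff₀ (by linarith)]
    nlinarith [mul_nonneg h0 h0, mul_nonneg (mul_nonneg h0 h0) h0,
      mul_nonneg (mul_nonneg h0 h0) (mul_nonneg h0 h0),
      mul_nonneg (mul_nonneg (mul_nonneg h0 h0) (mul_nonneg h0 h0)) h0]
  have h5 : (1-y) ^ (-(1/4) : ℝ) = ((1-y)⁻¹) ^ ((1/4) : ℝ) := by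
    rw [Real.rpow_neg (by linarith), Real.inv_rpow (by linarith)]
  rw [h5]
  calc 1 + y/4 = ((1+y/4)^4) ^ ((1/4) : ℝ) := by
        rw [← Real.rpow_natCast, ← Real.rpow_mul (by positivity)]; norm_num
    _ ≤ _ := Real.rpow_le_rpow (by positivity) h4 (by norm_num)

noncomputable def del : ℝ := (99:ℝ) ^ (-(1/4) : ℝ) - (100:ℝ) ^ (-(1/4) : ℝ)

lemma del_pos : 0 < del := by
  unfold del
  have : (100:ℝ) ^ (-(1/4) : ℝ) < (99:ℝ) ^ (-(1/4) : ℝ) :=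
    Real.rpow_lt_rpow_of_neg (by norm_num) (by norm_num) (by norm_num)
  linarith

lemma super (hd : 3 ≤ d) (x : Zd d) :
    (if x = 0 then del else 0) + ∑ p, (2 * d : ℝ)⁻¹ * hf (x + stp p) ≤ hf x := by
  have hdR : (3:ℝ) ≤ d := by exact_mod_cast hd
  by_cases hx : x = 0
  · subst hx
    have h0 : sq (0 : Zd d) = 0 := by simp [sq]
    have : ∀ p, hf ((0 : Zd d) + stp p) = (100:ℝ) ^ (-(1/4) : ℝ) := by
      rintro ⟨j, b⟩
      rw [hf, sq_stp, h0]; norm_num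
    simp only [this, if_true, Finset.sum_const, Finset.card_univ, Fintype.card_prod,
        Fintype.card_fin, Fintype.card_bool, nsmul_eq_mul]
    push_cast
    rw [hf, h0, del, zero_add, ← mul_assoc, mul_comm (d:ℝ) 2,
      mul_inv_cancel₀ (by positivity)]
    linarith
  · rw [if_neg hx, zero_add]
    have hS := sq_nonneg' x
    set S := sq x with hSdef
    set s := S + 100 with hs
    have hspos : 0 < s := by linarith
    have hp : 0 < s ^ (-(1/4) : ℝ) := Real.rpow_pos_of_pos hspos _
    have hb : ∀ j, ∀ b, hf (x + stp (j, b)) ≤ s ^ (-(1/4) : ℝ) *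
        (1 - (2 * (if b then 1 else -1) * x j / s)/4 + 3*(2 * x j / s)^2/16) := by
      intro j b
      have hj : (x j : ℝ)^2 ≤ S := by
        rw [hSdef, sq]
        exact Finset.single_le_sum (f := fun i => (x i : ℝ)^2)
          (fun i _ => _root_.sq_nonneg _) (Finset.mem_univ j)
      have hε : ((if b then 1 else -1 : ℝ))^2 = 1 := by cases b <;> norm_num
      set ε := (if b then 1 else -1 : ℝ)
      have ht : (2 * ε * x j / s)^2 = (2 * x j / s)^2 := by
        rw [div_pow, div_pow, mul_pow, mul_pow, hε, mul_pow]; ring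
      have ht2 : (2 * ε * x j / s)^2 ≤ 1/100 := by
        rw [ht, div_pow, div_le_iff₀ (by positivity)]
        nlinarith [_root_.sq_nonneg (S - 100)]
      have h1 : -(1/10) ≤ 2 * ε * x j / s := by nlinarith
      rw [hf, sq_stp, show S + 2 * ε * x j + 1 + 99 = s * (1 + 2 * ε * x j / s) by
        field_simp; rw [hs]; ring, Real.mul_rpow hspos.le (by linarith)]
      have := q_bound _ ht2
      rw [ht] at this
      exact mul_le_mul_of_nonneg_left this hp.le
    have hsum : ∑ p, hf (x + stp p) ≤ s ^ (-(1/4) : ℝ) * (2 * d + 3/2 * (S / s^2)) := by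
      rw [Fintype.sum_prod_type]
      calc ∑ j, ∑ b, hf (x + stp (j, b)) ≤ ∑ j, s ^ (-(1/4) : ℝ) * (2 + 3/2 * ((x j)^2/s^2)) := by
            apply Finset.sum_le_sum
            intro j _
            rw [Fintype.sum_bool]
            have h1 := hb j true
            have h2 := hb j false
            calc _ ≤ _ := add_le_add h1 h2
              _ = _ := by simp; ring
        _ = _ := by
            rw [← Finset.mul_sum, Finset.sum_add_distrib, ← Finset.mul_sum, ← Finset.sum_div]
            have e : ∑ i, (x i : ℝ)^2 = S := rfl
            rw [e, Finset.sum_const, Finset.card_univ, Fintype.card_fin, nsmul_eq_mul, mul_comm (d:ℝ) 2]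
    rw [← Finset.mul_sum]
    have hfx : s ^ (-(1/4) : ℝ) * (1 + (1/s)/4) ≤ hf x := by
      rw [hf, show sq x + 99 = s * (1 - 1/s) by field_simp; rw [hs]; ring]
      have : 1/s ≤ 1/100 := one_div_le_one_div_of_le (by norm_num) (by linarith)
      rw [Real.mul_rpow hspos.le (by linarith)]
      exact mul_le_mul_of_nonneg_left (r_bound _ (by positivity) this) hp.le
    refine le_trans ?_ hfx
    calc (2 * d : ℝ)⁻¹ * ∑ p, hf (x + stp p)
        ≤ (2 * d : ℝ)⁻¹ * (s ^ (-(1/4) : ℝ) * (2 * d + 3/2 * (S / s^2))) :=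
          mul_le_mul_of_nonneg_left hsum (by positivity)
      _ = s ^ (-(1/4) : ℝ) * (1 + 3/4 * (S/s^2) / d) := by field_simp; ring
      _ ≤ _ := by
          apply mul_le_mul_of_nonneg_left _ hp.le
          have h1 : S/s^2 ≤ 1/s := by
            rw [div_le_div_iff₀ (by positivity) hspos]; nlinarith
          have h2 : 3/4 * (S/s^2) / d ≤ 3/4 * (S/s^2) / 3 :=
            div_le_div_of_nonneg_left (by positivity) (by norm_num) hdR
          linarith

/-- heat kernel -/
noncomputable def pk (P : Zd d → Measure (ℕ → Zd d)) (n : ℕ) (x y : Zd d) : ℝ≥0∞ :=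
  P x {w | w n = y}

noncomputable def gr (P : Zd d → Measure (ℕ → Zd d)) (x y : Zd d) : ℝ≥0∞ := ∑' n, pk P n x y

lemma meas_at (n : ℕ) (y : Zd d) : MeasurableSet {w : ℕ → Zd d | w n = y} :=
  (measurable_pi_apply (X := fun _ : ℕ => Zd d) n) (measurableSet_singleton y)

lemma meas_esc (K : Finset (Zd d)) : MeasurableSet (escSet d K) := by
  have : escSet d K = ⋂ n, ⋂ (_ : 1 ≤ n), ⋂ y ∈ K, {w : ℕ → Zd d | w n = y}ᶜ := by
    ext w
    simp only [escSet, Set.mem_ofPred_eq, Set.mem_iInter, Set.mem_compl_iff]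
    constructor
    · intro h n hn y hy he
      exact h n hn (he ▸ hy)
    · intro h n hn hy
      exact h n hn _ hy rfl
  rw [this]
  exact MeasurableSet.iInter fun n => MeasurableSet.iInter fun _ => MeasurableSet.iInter fun y =>
    MeasurableSet.iInter fun _ => (meas_at n y).compl

lemma pk_succ (hP : IsSRW d P) (hd : 3 ≤ d) (n : ℕ) (x y : Zd d) :
    pk P (n+1) x y = ∑ p, (2 * d : ℝ≥0∞)⁻¹ * pk P n (x + stp p) y :=
  markov hP hd x _ (meas_at n y)

lemma pk_zero_le (hP : IsSRW d P) (x y : Zd d) : pk P 0 x y ≤ if x = y then 1 else 0 := by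
  have := hP.1 x
  split_ifs with h
  · exact prob_le_one
  · refine le_of_eq (measure_mono_null ?_ (ae_iff.1 (start hP x)))
    intro w hw h2
    exact h (h2.symm.trans hw)

lemma superE (hd : 3 ≤ d) (x : Zd d) :
    (if x = 0 then ENNReal.ofReal del else 0) +
      ∑ p, (2 * d : ℝ≥0∞)⁻¹ * ENNReal.ofReal (hf (x + stp p)) ≤ ENNReal.ofReal (hf x) := by
  have hd0 : (0:ℝ) < 2 * d := by
    have : 0 < d := by omega
    positivity
  have e : (2 * d : ℝ≥0∞)⁻¹ = ENNReal.ofReal ((2 * d : ℝ)⁻¹) := by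
    rw [ENNReal.ofReal_inv_of_pos hd0, ENNReal.ofReal_mul (by norm_num)]
    simp
  have h1 : ∑ p, (2 * d : ℝ≥0∞)⁻¹ * ENNReal.ofReal (hf (x + stp p)) =
      ENNReal.ofReal (∑ p, (2 * d : ℝ)⁻¹ * hf (x + stp p)) := by
    rw [ENNReal.ofReal_sum_of_nonneg]
    · apply Finset.sum_congr rfl
      intro p _
      rw [e, ENNReal.ofReal_mul (by positivity)]
    · intro p _
      have := hf_pos (x + stp p)
      positivity
  have h2 : (if x = 0 then ENNReal.ofReal del else 0) =
      ENNReal.ofReal (if x = 0 then del else 0) := by split_ifs <;> simp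
  rw [h1, h2, ← ENNReal.ofReal_add]
  · exact ENNReal.ofReal_le_ofReal (super hd x)
  · split_ifs
    · exact del_pos.le
    · exact le_rfl
  · apply Finset.sum_nonneg
    intro p _
    have := hf_pos (x + stp p)
    positivity

lemma gr_bound (hP : IsSRW d P) (hd : 3 ≤ d) (x y : Zd d) :
    ENNReal.ofReal del * gr P x y ≤ ENNReal.ofReal (hf (x - y)) := by
  have key : ∀ N : ℕ, ∀ x, ENNReal.ofReal del * ∑ n ∈ Finset.range N, pk P n x y ≤
      ENNReal.ofReal (hf (x - y)) := by
    intro N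
    induction N with
    | zero => intro x; simp
    | succ N ih =>
      intro x
      rw [Finset.sum_range_succ']
      calc ENNReal.ofReal del * (∑ n ∈ Finset.range N, pk P (n+1) x y + pk P 0 x y)
          = ENNReal.ofReal del * pk P 0 x y + ∑ p, (2 * d : ℝ≥0∞)⁻¹ *
              (ENNReal.ofReal del * ∑ n ∈ Finset.range N, pk P n (x + stp p) y) := by
            simp only [pk_succ hP hd]
            rw [Finset.sum_comm, mul_add, add_comm]
            congr 1
            rw [Finset.mul_sum]
            apply Finset.sum_congr rfl
            intro p _
            rw [← Finset.mul_sum]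
            ring
        _ ≤ (if x - y = 0 then ENNReal.ofReal del else 0) + ∑ p, (2 * d : ℝ≥0∞)⁻¹ *
              ENNReal.ofReal (hf (x - y + stp p)) := by
            gcongr with p
            · have := pk_zero_le hP x y
              simp only [sub_eq_zero]
              split_ifs at this ⊢ with h
              · exact (mul_le_mul_right this _).trans (by simp)
              · simp [nonpos_iff_eq_zero.1 this]
            · have := ih (x + stp p)
              rwa [show x + stp p - y = x - y + stp p by abel] at this
        _ ≤ _ := superE hd (x - y)
  rw [gr, ← ENNReal.tsum_mul_left, ENNReal.tsum_eq_iSup_nat]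
  refine iSup_le fun N => ?_
  rw [← Finset.mul_sum]
  exact key N x

lemma last (hP : IsSRW d P) (hd : 3 ≤ d) (K : Finset (Zd d)) (y : Zd d) (n : ℕ) :
    ∀ x, P x {w | w n = y ∧ (fun k => w (n + k)) ∈ escSet d K} ≤ pk P n x y * P y (escSet d K) := by
  induction n with
  | zero =>
    intro x
    by_cases h : x = y
    · subst h
      have h1 : pk P 0 x x = 1 := by
        have := hP.1 x
        have := start hP x
        exact (mem_ae_iff_prob_eq_one (meas_at 0 x)).1 this
      rw [h1, one_mul]
      apply measure_mono
      rintro w ⟨-, hw⟩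
      simpa using hw
    · refine le_trans (le_of_eq (measure_mono_null ?_ (ae_iff.1 (start hP x)))) zero_le
      rintro w ⟨hw, -⟩ h2
      exact h (h2.symm.trans hw)
  | succ n ih =>
    intro x
    have hm : MeasurableSet {w : ℕ → Zd d | w n = y ∧ (fun k => w (n + k)) ∈ escSet d K} := by
      refine (meas_at n y).inter ?_
      exact (measurable_pi_lambda (fun w : ℕ → Zd d => fun k => w (n+k))
        fun k => measurable_pi_apply (n+k)) (meas_esc K)
    have e : {w : ℕ → Zd d | w (n+1) = y ∧ (fun k => w (n + 1 + k)) ∈ escSet d K} =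
        shift ⁻¹' {w : ℕ → Zd d | w n = y ∧ (fun k => w (n + k)) ∈ escSet d K} := by
      ext w
      simp only [shift, Set.mem_preimage, Set.mem_ofPred_eq, Nat.add_right_comm]
    rw [e, markov hP hd x _ hm, pk_succ hP hd, Finset.sum_mul]
    apply Finset.sum_le_sum
    intro p _
    rw [mul_assoc]
    gcongr
    exact ih _

lemma gr_lt_top (hP : IsSRW d P) (hd : 3 ≤ d) (x y : Zd d) : gr P x y < ⊤ := by
  by_contra h
  have h1 : gr P x y = ⊤ := by simpa using h
  have := gr_bound hP hd x y
  rw [h1, ENNReal.mul_top (by simpa using del_pos)] at this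
  simp at this

lemma one_le (hP : IsSRW d P) (hd : 3 ≤ d) (K : Finset (Zd d)) (x : Zd d) (hx : x ∈ K) :
    1 ≤ ∑ y ∈ K, gr P x y * P y (escSet d K) := by
  have hprob := hP.1 x
  have hfin : ∀ᵐ w ∂(P x), ∀ y ∈ K, ∀ᶠ n in Filter.atTop, w n ≠ y := by
    rw [Filter.eventually_all_finset]
    intro y _
    have := ae_eventually_notMem (μ := P x) (s := fun n => {w : ℕ → Zd d | w n = y})
      (gr_lt_top hP hd x y).ne
    exact this
  have hcov : ∀ᵐ w ∂(P x), w ∈ ⋃ n : ℕ, ⋃ y ∈ K,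
      {w : ℕ → Zd d | w n = y ∧ (fun k => w (n + k)) ∈ escSet d K} := by
    filter_upwards [hfin, start hP x] with w hw h0
    have hw2 : ∀ᶠ n in Filter.atTop, ∀ y ∈ K, w n ≠ y := (Filter.eventually_all_finset K).2 hw
    obtain ⟨M, hM⟩ := Filter.eventually_atTop.1 hw2
    classical
    have hne : w 0 ∈ K := h0 ▸ hx
    have hgs := Nat.findGreatest_spec (P := fun n => w n ∈ K) (Nat.zero_le M) hne
    simp only [Set.mem_iUnion]
    refine ⟨Nat.findGreatest (fun n => w n ∈ K) M, _, hgs, rfl, ?_⟩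
    intro k hk hmem
    by_cases hle : Nat.findGreatest (fun n => w n ∈ K) M + k ≤ M
    · have := Nat.le_findGreatest (P := fun n => w n ∈ K) hle hmem
      omega
    · exact hM _ (by omega) _ hmem rfl
  calc (1 : ℝ≥0∞) = P x (⋃ n : ℕ, ⋃ y ∈ K,
      {w : ℕ → Zd d | w n = y ∧ (fun k => w (n + k)) ∈ escSet d K}) := by
        have e : P x (⋃ n : ℕ, ⋃ y ∈ K,
            {w : ℕ → Zd d | w n = y ∧ (fun k => w (n + k)) ∈ escSet d K}) = P x Set.univ :=
          measure_congr (Filter.eventuallyEq_univ.2 hcov)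
        rw [e, measure_univ]
    _ ≤ ∑' n : ℕ, P x (⋃ y ∈ K,
      {w : ℕ → Zd d | w n = y ∧ (fun k => w (n + k)) ∈ escSet d K}) := measure_iUnion_le _
    _ ≤ ∑' n : ℕ, ∑ y ∈ K, pk P n x y * P y (escSet d K) := by
        refine ENNReal.tsum_le_tsum fun n => ?_
        refine (measure_biUnion_finset_le _ _).trans ?_
        exact Finset.sum_le_sum fun y _ => last hP hd K y n x
    _ = _ := by
        rw [Summable.tsum_finsetSum (fun _ _ => ENNReal.summable)]
        simp only [ENNReal.tsum_mul_right, gr]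

lemma cap_bound (hP : IsSRW d P) (hd : 3 ≤ d) (K : Finset (Zd d)) (M : ℝ)
    (hM : ∀ y ∈ K, ∑ x ∈ K, hf (x - y) ≤ M) :
    (K.card : ℝ) * del ≤ M * (capa d P K).toReal := by
  have hM' : ∀ y ∈ K, ENNReal.ofReal del * ∑ x ∈ K, gr P x y ≤ ENNReal.ofReal M := by
    intro y hy
    rw [Finset.mul_sum]
    calc _ ≤ ∑ x ∈ K, ENNReal.ofReal (hf (x - y)) :=
          Finset.sum_le_sum fun x _ => gr_bound hP hd x y
      _ = ENNReal.ofReal (∑ x ∈ K, hf (x - y)) :=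
          (ENNReal.ofReal_sum_of_nonneg fun x _ => (hf_pos _).le).symm
      _ ≤ _ := ENNReal.ofReal_le_ofReal (hM y hy)
  have h1 : (K.card : ℝ≥0∞) * ENNReal.ofReal del ≤ ENNReal.ofReal M * capa d P K := by
    calc (K.card : ℝ≥0∞) * ENNReal.ofReal del = ENNReal.ofReal del * ∑ x ∈ K, 1 := by
          rw [mul_comm]; simp
      _ ≤ ENNReal.ofReal del * ∑ x ∈ K, ∑ y ∈ K, gr P x y * P y (escSet d K) := by
          gcongr with x hx
          exact one_le hP hd K x hx
      _ = ∑ y ∈ K, (ENNReal.ofReal del * ∑ x ∈ K, gr P x y) * P y (escSet d K) := by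
          rw [Finset.sum_comm, Finset.mul_sum]
          apply Finset.sum_congr rfl
          intro y _
          rw [← Finset.sum_mul, mul_assoc]
      _ ≤ ∑ y ∈ K, ENNReal.ofReal M * P y (escSet d K) := by
          gcongr with y hy
          exact hM' y hy
      _ = _ := by
          rw [capa, Finset.mul_sum]
          apply Finset.sum_congr rfl
          intro y hy
          rw [eqm, if_pos hy]
  have hcap : capa d P K ≠ ⊤ := by
    rw [capa]
    refine (ENNReal.sum_lt_top.2 fun y hy => ?_).ne
    have := hP.1 y
    rw [eqm, if_pos hy]
    exact measure_lt_top _ _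
  by_cases hK : K.Nonempty
  · obtain ⟨y, hy⟩ := hK
    have hM0 : 0 ≤ M := le_trans (Finset.sum_nonneg fun x _ => (hf_pos _).le) (hM y hy)
    have := ENNReal.toReal_mono (ENNReal.mul_ne_top ENNReal.ofReal_ne_top hcap) h1
    simpa [ENNReal.toReal_mul, ENNReal.toReal_ofReal del_pos.le, ENNReal.toReal_ofReal hM0]
      using this
  · rw [Finset.not_nonempty_iff_eq_empty.1 hK]
    simp [capa]

noncomputable def box (d : ℕ) : Finset (Zd d) := Fintype.piFinset fun _ => Finset.Icc (-18) 18

lemma box_card : (box d).card = 37 ^ d := by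
  simp [box, Fintype.card_piFinset]

lemma mem_box (i : Zd d) : i ∈ box d ↔ ∀ k, -18 ≤ i k ∧ i k ≤ 18 := by
  simp [box, Fintype.mem_piFinset]

open Classical in
noncomputable def Fam {d : ℕ} : ℕ → Zd d → Finset (Finset (Zd d))
  | 0, z => {{z}}
  | n + 1, z => ((box d ×ˢ box d).filter (fun ij => ∃ k, 8 ≤ |ij.1 k - ij.2 k|)).biUnion
      fun ij => Finset.image₂ (· ∪ ·) (Fam n (fun k => z k + 9 ^ n * ij.1 k))
        (Fam n (fun k => z k + 9 ^ n * ij.2 k))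

lemma mem_Fam_succ (n : ℕ) (z : Zd d) (T : Finset (Zd d)) : T ∈ Fam (n+1) z ↔
    ∃ i j : Zd d, i ∈ box d ∧ j ∈ box d ∧ (∃ k, 8 ≤ |i k - j k|) ∧
      ∃ A ∈ Fam n (fun k => z k + 9 ^ n * i k), ∃ B ∈ Fam n (fun k => z k + 9 ^ n * j k),
        A ∪ B = T := by
  classical
  simp only [Fam, Finset.mem_biUnion, Finset.mem_filter, Finset.mem_product, Finset.mem_image₂,
    Prod.exists]
  constructor
  · rintro ⟨i, j, ⟨⟨h1, h2⟩, h3⟩, A, hA, B, hB, rfl⟩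
    exact ⟨i, j, h1, h2, h3, A, hA, B, hB, by congr⟩
  · rintro ⟨i, j, h1, h2, h3, A, hA, B, hB, rfl⟩
    exact ⟨i, j, ⟨⟨h1, h2⟩, h3⟩, A, hA, B, hB, by congr⟩

lemma Fam_card (n : ℕ) : ∀ z : Zd d, (37 ^ d * 37 ^ d) * (Fam n z).card ≤ (37 ^ d * 37 ^ d) ^ 2 ^ n := by
  induction n with
  | zero => intro z; simp [Fam]
  | succ n ih =>
    intro z
    classical
    set B := 37 ^ d * 37 ^ d with hB
    have hBpos : 0 < B := by positivity
    have h1 : B * (Fam (n+1) z).card * B ≤ B * (B ^ 2 ^ n * B ^ 2 ^ n) := by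
      have h2 : (Fam (n+1) z).card * (B * B) ≤ B * (B ^ 2 ^ n * B ^ 2 ^ n) := by
        rw [Fam]
        calc _ ≤ (∑ ij ∈ (box d ×ˢ box d).filter (fun ij => ∃ k, 8 ≤ |ij.1 k - ij.2 k|),
              (Fam n (fun k => z k + 9 ^ n * ij.1 k)).card *
              (Fam n (fun k => z k + 9 ^ n * ij.2 k)).card) * (B * B) := by
                gcongr
                refine Finset.card_biUnion_le.trans ?_
                exact Finset.sum_le_sum fun ij _ => Finset.card_image₂_le _ _ _
          _ = ∑ ij ∈ (box d ×ˢ box d).filter (fun ij => ∃ k, 8 ≤ |ij.1 k - ij.2 k|),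
              (B * (Fam n (fun k => z k + 9 ^ n * ij.1 k)).card) *
              (B * (Fam n (fun k => z k + 9 ^ n * ij.2 k)).card) := by
                rw [Finset.sum_mul]
                apply Finset.sum_congr rfl
                intro ij _
                ring
          _ ≤ ∑ ij ∈ (box d ×ˢ box d).filter (fun ij => ∃ k, 8 ≤ |ij.1 k - ij.2 k|),
              B ^ 2 ^ n * B ^ 2 ^ n := by
                gcongr
                · exact ih _
                · exact ih _
          _ ≤ _ := by
                rw [Finset.sum_const, smul_eq_mul]
                gcongr
                refine (Finset.card_filter_le _ _).trans ?_
                rw [Finset.card_product, box_card]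
      calc B * (Fam (n+1) z).card * B = (Fam (n+1) z).card * (B * B) := by ring
        _ ≤ _ := h2
    have h3 : B * (Fam (n+1) z).card ≤ B ^ 2 ^ n * B ^ 2 ^ n := by
      rw [mul_comm _ B] at h1
      exact Nat.le_of_mul_le_mul_left h1 hBpos
    rwa [← pow_add, ← two_mul, ← pow_succ'] at h3

lemma hf_far (n : ℕ) (x : Zd d) (h : ∃ k, (9:ℤ) ^ n ≤ |x k|) : hf x ≤ (1/3)^n := by
  obtain ⟨k, hk⟩ := h
  have hk' : ((9:ℝ)^n)^2 ≤ sq x := by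
    have h1 : (9:ℝ)^n ≤ |(x k : ℝ)| := by exact_mod_cast hk
    calc ((9:ℝ)^n)^2 ≤ |(x k : ℝ)|^2 := by gcongr
      _ = (x k : ℝ)^2 := sq_abs _
      _ ≤ sq x := Finset.single_le_sum (f := fun i => (x i : ℝ)^2)
          (fun i _ => _root_.sq_nonneg _) (Finset.mem_univ k)
  have h3 : ((9:ℝ)^n)^2 = ((3:ℝ)^n)^(4:ℕ) := by
    rw [← pow_mul, ← pow_mul, show (9:ℝ) = 3^2 by norm_num, ← pow_mul]; congr 1; ring
  calc hf x ≤ (((3:ℝ)^n)^(4:ℕ)) ^ (-(1/4) : ℝ) := by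
        apply Real.rpow_le_rpow_of_nonpos (by positivity) (by linarith) (by norm_num)
    _ = (1/3)^n := by
        rw [← Real.rpow_natCast, ← Real.rpow_mul (by positivity)]
        norm_num
        rw [Real.rpow_neg_one, one_div, inv_pow]

lemma Fam_near (n : ℕ) : ∀ (z : Zd d), ∀ T ∈ Fam n z, ∀ y ∈ T, ∀ k,
    |y k - z k| ≤ 3 * 9 ^ n := by
  induction n with
  | zero =>
    intro z T hT y hy k
    simp only [Fam, Finset.mem_singleton] at hT
    subst hT
    simp only [Finset.mem_singleton] at hy
    subst hy
    simp
  | succ n ih =>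
    intro z T hT y hy k
    obtain ⟨i, j, hi, hj, -, A, hA, B, hB, rfl⟩ := (mem_Fam_succ n z T).1 hT
    have aux : ∀ i : Zd d, i ∈ box d → |y k - (z k + 9 ^ n * i k)| ≤ 3 * 9 ^ n →
        |y k - z k| ≤ 3 * 9 ^ (n+1) := by
      intro i hi h
      have := (mem_box i).1 hi k
      have h9 : (0:ℤ) < 9 ^ n := by positivity
      rw [pow_succ]
      rw [abs_le] at h ⊢
      constructor <;> nlinarith
    rcases Finset.mem_union.1 hy with h | h
    · exact aux i hi (ih _ A hA y h k)
    · exact aux j hj (ih _ B hB y h k)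

lemma Fam_sep (n : ℕ) (z i j : Zd d) (hij : ∃ k, 8 ≤ |i k - j k|) (A B : Finset (Zd d))
    (hA : A ∈ Fam n (fun k => z k + 9 ^ n * i k)) (hB : B ∈ Fam n (fun k => z k + 9 ^ n * j k))
    (x y : Zd d) (hx : x ∈ A) (hy : y ∈ B) : ∃ k, (9:ℤ)^n ≤ |x k - y k| := by
  obtain ⟨k, hk⟩ := hij
  refine ⟨k, ?_⟩
  have h1 := abs_le.1 (Fam_near n _ A hA x hx k)
  have h2 := abs_le.1 (Fam_near n _ B hB y hy k)
  have h9 : (0:ℤ) < 9 ^ n := by positivity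
  rw [le_abs] at hk ⊢
  rcases hk with hk | hk
  · left; nlinarith
  · right; nlinarith

lemma Fam_props (n : ℕ) : ∀ (z : Zd d), ∀ T ∈ Fam n z, T.card = 2 ^ n ∧
    ∀ y ∈ T, ∑ x ∈ T, hf (x - y) ≤ 4 - 3 * (2/3 : ℝ)^n := by
  induction n with
  | zero =>
    intro z T hT
    simp only [Fam, Finset.mem_singleton] at hT
    subst hT
    refine ⟨by simp, ?_⟩
    intro y hy
    simp only [Finset.mem_singleton] at hy
    subst hy
    simp only [Finset.sum_singleton, sub_self, pow_zero]
    have : hf (0 : Zd d) ≤ 1 := by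
      apply Real.rpow_le_one_of_one_le_of_nonpos
      · have := sq_nonneg' (0 : Zd d); linarith
      · norm_num
    linarith
  | succ n ih =>
    intro z T hT
    obtain ⟨i, j, hi, hj, hij, A, hA, B, hB, rfl⟩ := (mem_Fam_succ n z T).1 hT
    have hs := Fam_sep n z i j hij A B hA hB
    have h9 : (0:ℤ) < 9 ^ n := by positivity
    have hdisj : Disjoint A B := by
      rw [Finset.disjoint_left]
      intro x hx hy
      obtain ⟨k, hk⟩ := hs x x hx hy
      simp at hk
      omega
    obtain ⟨cA, sA⟩ := ih _ A hA
    obtain ⟨cB, sB⟩ := ih _ B hB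
    refine ⟨by rw [Finset.card_union_of_disjoint hdisj, cA, cB]; ring, ?_⟩
    have e23 : (2:ℝ)^n * (1/3)^n = (2/3)^n := by rw [← mul_pow]; norm_num
    intro y hy
    rw [Finset.sum_union hdisj, pow_succ]
    rcases Finset.mem_union.1 hy with h | h
    · have h1 := sA y h
      have h2 : ∑ x ∈ B, hf (x - y) ≤ (2/3)^n := by
        calc _ ≤ ∑ x ∈ B, (1/3 : ℝ)^n := by
              apply Finset.sum_le_sum
              intro x hx
              apply hf_far
              obtain ⟨k, hk⟩ := hs y x h hx
              exact ⟨k, by rwa [Pi.sub_apply, abs_sub_comm]⟩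
          _ = _ := by rw [Finset.sum_const, cB, nsmul_eq_mul, ← e23]; push_cast; ring
      linarith
    · have h1 := sB y h
      have h2 : ∑ x ∈ A, hf (x - y) ≤ (2/3)^n := by
        calc _ ≤ ∑ x ∈ A, (1/3 : ℝ)^n := by
              apply Finset.sum_le_sum
              intro x hx
              apply hf_far
              exact hs x y hx h
          _ = _ := by rw [Finset.sum_const, cA, nsmul_eq_mul, ← e23]; push_cast; ring
      linarith

/-- vacant adjacency -/
def vadj (ω : Zd d → Bool) (x y : Zd d) : Prop := adj y x ∧ ω x = true ∧ ω y = true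

lemma adj_le {x y : Zd d} (h : adj y x) (k : Fin d) : |y k - x k| ≤ 1 := by
  unfold adj at h
  have := Finset.single_le_sum (f := fun i => (y i - x i).natAbs) (fun i _ => Nat.zero_le _)
    (Finset.mem_univ k)
  simp only [h] at this
  rw [abs_le]; omega

lemma vadj_symm {ω : Zd d → Bool} {x y : Zd d} (h : vadj ω x y) : vadj ω y x := by
  refine ⟨?_, h.2.2, h.2.1⟩
  have := h.1
  unfold adj at *
  rw [← this]
  apply Finset.sum_congr rfl
  intro i _
  omega

lemma conn_symm {ω : Zd d → Bool} {a b : Zd d} (h : Relation.ReflTransGen (vadj ω) a b) :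
    Relation.ReflTransGen (vadj ω) b a := by
  induction h with
  | refl => exact .refl
  | tail _ h ih => exact .head (vadj_symm h) ih

lemma trunc {ω : Zd d → Bool} {a b z : Zd d} (m : ℤ) (h : Relation.ReflTransGen (vadj ω) a b)
    (ha : ∀ k, |a k - z k| < m) (hb : ∃ k, m ≤ |b k - z k|) :
    ∃ c, Relation.ReflTransGen (vadj ω) a c ∧ (∃ k, m ≤ |c k - z k|) ∧ ∀ k, |c k - z k| ≤ m := by
  induction h with
  | refl =>
    obtain ⟨k, hk⟩ := hb
    exact absurd (ha k) (not_lt.2 hk)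
  | @tail b c hab hbc ih =>
    by_cases hb' : ∃ k, m ≤ |b k - z k|
    · exact ih hb'
    · push Not at hb'
      refine ⟨c, hab.tail hbc, hb, fun k => ?_⟩
      have h1 := hb' k
      have h2 := adj_le hbc.1 k
      rw [abs_lt] at h1
      rw [abs_le] at h2 ⊢
      omega

lemma exists_Fam {ω : Zd d → Bool} (n : ℕ) : ∀ (z a b : Zd d),
    Relation.ReflTransGen (vadj ω) a b → (∀ k, |a k - z k| < 9 ^ n) →
    (∃ k, 2 * 9 ^ n ≤ |b k - z k|) → ∃ T ∈ Fam n z, ∀ y ∈ T, ω y = true := by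
  induction n with
  | zero =>
    intro z a b hab ha hb
    have haz : a = z := by
      funext k
      have := ha k
      rw [pow_zero, abs_lt] at this
      omega
    subst haz
    refine ⟨{a}, by simp [Fam], ?_⟩
    intro y hy
    rw [Finset.mem_singleton] at hy
    subst hy
    rcases Relation.ReflTransGen.cases_head hab with h | ⟨c, h, -⟩
    · subst h
      obtain ⟨k, hk⟩ := hb
      simp at hk
    · exact h.2.1
  | succ n ih =>
    intro z a b hab ha hb
    have h9 : (0:ℤ) < 9 ^ n := by positivity
    set L : ℤ := 9 ^ n with hL
    have hL1 : (9:ℤ)^(n+1) = 9 * L := by rw [pow_succ]; ring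
    rw [hL1] at ha hb
    obtain ⟨c, hac, ⟨k, hk⟩, hc⟩ := trunc (2 * (9 * L)) hab
      (fun k => (ha k).trans (by linarith)) hb
    have fl : ∀ t : ℤ, L * (t / L) ≤ t ∧ t < L * (t / L) + L := fun t =>
      ⟨Int.mul_ediv_self_le h9.ne', by have := Int.lt_mul_ediv_self_add (x := t) h9; exact this⟩
    let i : Zd d := fun k => (a k - z k) / L
    let j : Zd d := fun k => (c k - z k) / L
    have hi : ∀ k, L * i k ≤ a k - z k ∧ a k - z k < L * i k + L := fun k => fl _
    have hj : ∀ k, L * j k ≤ c k - z k ∧ c k - z k < L * j k + L := fun k => fl _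
    have hib : i ∈ box d := by
      rw [mem_box]
      intro k
      have h1 := hi k
      have h2 := abs_lt.1 (ha k)
      constructor <;> nlinarith
    have hjb : j ∈ box d := by
      rw [mem_box]
      intro k
      have h1 := hj k
      have h2 := abs_le.1 (hc k)
      constructor
      · by_contra hcon
        have : j k ≤ -19 := by omega
        nlinarith
      · by_contra hcon
        have : 19 ≤ j k := by omega
        nlinarith
    have hak := abs_lt.1 (ha k)
    have hik := hi k
    have hjk := hj k
    obtain ⟨A, hA, vA⟩ := ih (fun k => z k + L * i k) a c hac
      (fun k => by have := hi k; rw [abs_lt]; constructor <;> linarith)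
      ⟨k, by
        rw [le_abs] at hk ⊢
        rcases hk with hk | hk
        · left; linarith
        · right; linarith⟩
    obtain ⟨B, hB, vB⟩ := ih (fun k => z k + L * j k) c a (conn_symm hac)
      (fun k => by have := hj k; rw [abs_lt]; constructor <;> linarith)
      ⟨k, by
        rw [le_abs] at hk ⊢
        rcases hk with hk | hk
        · right; linarith
        · left; linarith⟩
    refine ⟨A ∪ B, (mem_Fam_succ n z _).2 ⟨i, j, hib, hjb, ⟨k, ?_⟩, A, hA, B, hB, rfl⟩, ?_⟩
    · rw [le_abs] at hk ⊢
      rcases hk with hk | hk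
      · right; nlinarith
      · left; nlinarith
    · intro y hy
      rcases Finset.mem_union.1 hy with h | h
      · exact vA y h
      · exact vB y h

lemma Lscale_ge (d L0 : ℕ) (hL0 : 1 < L0) (n : ℕ) : 2 ≤ Lscale d L0 n := by
  induction n with
  | zero => exact hL0
  | succ n ih =>
    rw [Lscale]
    have h1 : 1 ≤ ⌊(Lscale d L0 n : ℝ) ^ ((1 : ℝ) / (100 * d))⌋₊ := by
      rw [Nat.le_floor_iff (by positivity)]
      push_cast
      apply Real.one_le_rpow
      · exact_mod_cast (by omega : 1 ≤ Lscale d L0 n)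
      · positivity
    nlinarith

lemma ell_le (hd : 3 ≤ d) (L0 : ℕ) (hL0 : 1 < L0) (n : ℕ) :
    (ellScale d L0 n : ℝ) ≤ 100 * (Lscale d L0 n : ℝ) := by
  have hN := Lscale_ge d L0 hL0 n
  have hN1 : (1:ℝ) ≤ Lscale d L0 n := by exact_mod_cast (by omega : 1 ≤ Lscale d L0 n)
  have hdR : (3:ℝ) ≤ d := by exact_mod_cast hd
  rw [ellScale]
  push_cast
  refine mul_le_mul_of_nonneg_left ?_ (by norm_num)
  calc _ ≤ (Lscale d L0 n : ℝ) ^ ((1 : ℝ) / (100 * d)) := Nat.floor_le (by positivity)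
    _ ≤ (Lscale d L0 n : ℝ) ^ (1:ℝ) := by
        apply Real.rpow_le_rpow_of_exponent_le hN1
        rw [div_le_one (by positivity)]
        linarith
    _ = _ := Real.rpow_one _

lemma cross_sub (L0 n m : ℕ) (i : Zd d)
    (hm : 2 * 9 ^ m ≤ Lscale d L0 n) :
    crossEvent d L0 n i ⊆ ⋃ a ∈ Fintype.piFinset (fun j => Finset.Ico (i j * (Lscale d L0 n : ℤ))
      ((i j + 1) * (Lscale d L0 n : ℤ))), ⋃ T ∈ Fam m a, {ω | ∀ z ∈ T, ω z = true} := by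
  rintro ω ⟨len, γ, h0, hlen, hv, hadj⟩
  have hmZ : (2:ℤ) * 9 ^ m ≤ Lscale d L0 n := by exact_mod_cast hm
  generalize hN : (Lscale d L0 n : ℤ) = N at *
  have hconn : ∀ k ≤ len, Relation.ReflTransGen (vadj ω) (γ 0) (γ k) := by
    intro k
    induction k with
    | zero => intro _; exact .refl
    | succ k ih =>
      intro hk
      exact (ih (by omega)).tail ⟨hadj k (by omega), (hv k (by omega)).2, (hv (k+1) hk).2⟩
  have hbox : ∀ j, i j * N ≤ γ 0 j ∧ γ 0 j < (i j + 1) * N := by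
    intro j
    have := h0 j
    rwa [hN] at this
  obtain ⟨T, hT, hTv⟩ := exists_Fam m (γ 0) (γ 0) (γ len) (hconn len le_rfl)
    (by intro k; simp) (by
      obtain ⟨hb, y, hy, hyn⟩ := hlen
      have : ∃ j, ¬ ((i j - 1) * N ≤ y j ∧ y j < (i j + 2) * N) := by
        by_contra hcon
        push Not at hcon
        apply hyn
        intro j
        rw [hN]
        exact hcon j
      obtain ⟨j, hj⟩ := this
      have h1 := abs_le.1 (adj_le hy j)
      have h2 := hbox j
      refine ⟨j, hmZ.trans ?_⟩
      rw [le_abs]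
      by_cases h3 : (i j - 1) * N ≤ y j
      · left
        have h4 : (i j + 2) * N ≤ y j := by
          by_contra h5
          exact hj ⟨h3, by linarith⟩
        have h6 : (i j + 2) * N = (i j + 1) * N + N := by ring
        omega
      · right
        have h6 : (i j - 1) * N = i j * N - N := by ring
        omega)
  simp only [Set.mem_iUnion]
  exact ⟨γ 0, by simpa [Fintype.mem_piFinset] using hbox, T, hT, hTv⟩

lemma Q_Fam (hd : 3 ≤ d) (hP : IsSRW d P) (u : ℝ) (hu : 0 ≤ u) (Q : Measure (Zd d → Bool))
    (hQ : IsVacantLaw d P u Q) (m : ℕ) (z : Zd d) (T : Finset (Zd d)) (hT : T ∈ Fam m z) :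
    Q {ω | ∀ z ∈ T, ω z = true} ≤ ENNReal.ofReal (Real.exp (-(u * del / 4)) ^ 2 ^ m) := by
  rw [hQ.2 T]
  apply ENNReal.ofReal_le_ofReal
  rw [← Real.exp_nat_mul]
  apply Real.exp_le_exp.2
  obtain ⟨hc, hs⟩ := Fam_props m z T hT
  have h := cap_bound hP hd T 4 (fun y hy => (hs y hy).trans (by
    have : (0:ℝ) ≤ (2/3)^m := by positivity
    linarith))
  rw [hc] at h
  have := mul_le_mul_of_nonneg_left h hu
  push_cast at this ⊢
  nlinarith

lemma final (hd : 3 ≤ d) (hP : IsSRW d P) (L0 : ℕ) (hL0 : 1 < L0) (u : ℝ)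
    (hu : 4 * Real.log ((37 ^ d * 37 ^ d : ℝ) * 18 ^ (3 * d)) / del ≤ u)
    (Q : Measure (Zd d → Bool)) (hQ : IsVacantLaw d P u Q) (n : ℕ) (i : Zd d) :
    (100 ^ (2 * (d - 1)))⁻¹ * (ellScale d L0 n : ℝ) ^ (2 * (d - 1)) *
      (Q (crossEvent d L0 n i)).toReal ≤ ((Lscale d L0 n : ℝ))⁻¹ := by
  have hN2 := Lscale_ge d L0 hL0 n
  have hell := ell_le hd L0 hL0 n
  have hdel := del_pos
  set N := Lscale d L0 n with hN
  have hNR : (2:ℝ) ≤ N := by exact_mod_cast hN2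
  set m := Nat.log 9 (N / 2) with hm
  have hm1 : 9 ^ m ≤ N / 2 := Nat.pow_log_le_self 9 (by omega)
  have hm2 : N / 2 < 9 ^ (m + 1) := Nat.lt_pow_succ_log_self (by norm_num) _
  have hNm : N ≤ 18 ^ 2 ^ m := by
    calc N ≤ 18 * 9 ^ m := by rw [pow_succ] at hm2; omega
      _ ≤ 18 * 18 ^ m := by gcongr; norm_num
      _ = 18 ^ (m + 1) := by ring
      _ ≤ 18 ^ 2 ^ m := Nat.pow_le_pow_right (by norm_num) Nat.lt_two_pow_self
  have hu0 : 0 ≤ u := by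
    refine le_trans ?_ hu
    have h1 : (1:ℝ) ≤ 37 ^ d := one_le_pow₀ (by norm_num)
    have h2 : (1:ℝ) ≤ 18 ^ (3 * d) := one_le_pow₀ (by norm_num)
    have := Real.log_nonneg (one_le_mul_of_one_le_of_one_le
      (one_le_mul_of_one_le_of_one_le h1 h1) h2)
    positivity
  set E := Real.exp (-(u * del / 4)) with hE
  have hEpos : 0 < E := Real.exp_pos _
  have hBE : (37 ^ d * 37 ^ d : ℝ) * E ≤ (18 ^ (3 * d))⁻¹ := by
    rw [div_le_iff₀ hdel] at hu
    have h1 : (37 ^ d * 37 ^ d : ℝ) * 18 ^ (3 * d) ≤ Real.exp (u * del / 4) := by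
      rw [← Real.log_le_iff_le_exp (by positivity)]
      linarith
    rw [hE, Real.exp_neg, ← div_eq_mul_inv, div_le_iff₀ (Real.exp_pos _), ← div_eq_inv_mul,
      le_div_iff₀ (by positivity)]
    exact h1
  set S := Fintype.piFinset (fun j => Finset.Ico (i j * (N : ℤ)) ((i j + 1) * (N : ℤ))) with hS
  have hScard : S.card = N ^ d := by
    rw [hS, Fintype.card_piFinset]
    have : ∀ j, ((i j + 1) * (N:ℤ) - i j * N).toNat = N := by
      intro j
      rw [show (i j + 1) * (N:ℤ) - i j * N = N by ring]; simp
    simp [Int.card_Ico, this]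
  have hQle : (Q (crossEvent d L0 n i)).toReal ≤ N ^ d * ((18 ^ (3 * d))⁻¹) ^ 2 ^ m := by
    apply ENNReal.toReal_le_of_le_ofReal (by positivity)
    calc Q (crossEvent d L0 n i) ≤ ∑ a ∈ S, ∑ T ∈ Fam m a, Q {ω | ∀ z ∈ T, ω z = true} := by
          refine (measure_mono (cross_sub L0 n m i (by omega))).trans ?_
          refine (measure_biUnion_finset_le _ _).trans ?_
          exact Finset.sum_le_sum fun a _ => measure_biUnion_finset_le _ _
      _ ≤ ∑ a ∈ S, ∑ T ∈ Fam m a, ENNReal.ofReal (E ^ 2 ^ m) := by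
          refine Finset.sum_le_sum fun a _ => Finset.sum_le_sum fun T hT => ?_
          exact Q_Fam hd hP u hu0 Q hQ m a T hT
      _ ≤ ∑ a ∈ S, ENNReal.ofReal (((18 ^ (3 * d))⁻¹) ^ 2 ^ m) := by
          refine Finset.sum_le_sum fun a _ => ?_
          rw [Finset.sum_const, nsmul_eq_mul, ← ENNReal.ofReal_natCast, ← ENNReal.ofReal_mul
            (by positivity)]
          apply ENNReal.ofReal_le_ofReal
          have hc : ((Fam m a).card : ℝ) ≤ (37 ^ d * 37 ^ d : ℝ) ^ 2 ^ m := by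
            have h1 := Fam_card m a
            have h2 : (Fam m a).card ≤ (37 ^ d * 37 ^ d) * (Fam m a).card :=
              Nat.le_mul_of_pos_left _ (by positivity)
            exact_mod_cast h2.trans h1
          calc ((Fam m a).card : ℝ) * E ^ 2 ^ m ≤ (37 ^ d * 37 ^ d : ℝ) ^ 2 ^ m * E ^ 2 ^ m := by
                gcongr
            _ = ((37 ^ d * 37 ^ d : ℝ) * E) ^ 2 ^ m := by rw [mul_pow _ E]
            _ ≤ _ := by gcongr
      _ = _ := by
          rw [Finset.sum_const, hScard, nsmul_eq_mul, ENNReal.ofReal_mul (by positivity)]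
          congr 1
          rw [ENNReal.ofReal_pow (by positivity), ENNReal.ofReal_natCast]
          push_cast
          rfl
  have hNpow : ((18 ^ (3 * d) : ℝ)⁻¹) ^ 2 ^ m ≤ ((N:ℝ) ^ (3 * d))⁻¹ := by
    rw [inv_pow]
    apply inv_anti₀ (by positivity)
    have : (N:ℝ) ≤ 18 ^ 2 ^ m := by exact_mod_cast hNm
    calc (N:ℝ) ^ (3 * d) ≤ (18 ^ 2 ^ m) ^ (3 * d) := by gcongr
      _ = _ := by rw [← pow_mul, ← pow_mul, mul_comm]
  have h1 : (100 ^ (2 * (d - 1)))⁻¹ * (ellScale d L0 n : ℝ) ^ (2 * (d - 1)) ≤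
      (N:ℝ) ^ (2 * (d - 1)) := by
    rw [← div_eq_inv_mul, div_le_iff₀ (by positivity), ← mul_pow, mul_comm (N:ℝ)]
    gcongr
  calc _ ≤ (N:ℝ) ^ (2 * (d - 1)) * (N ^ d * ((N:ℝ) ^ (3 * d))⁻¹) := by
        apply mul_le_mul h1 (hQle.trans _) ENNReal.toReal_nonneg (by positivity)
        gcongr
    _ ≤ (N:ℝ)⁻¹ := by
        have e : (N:ℝ) ^ (3 * d) = (N:ℝ) ^ (2 * (d - 1)) * N ^ d * (N * N) := by
          rw [← pow_two, ← pow_add, ← pow_add]; congr 1; omega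
        rw [e]
        have : (N:ℝ) ≠ 0 := by positivity
        field_simp
        linarith

end RK

/-- **Proposition 3.1 (key renormalization estimate).** There are constants
`c₁, c₂ > 0` and thresholds `c`, `c(L₀)`, `c(L₀,u₀)` such that with
`u_n = u₀ Π_{n'<n} (1 + c₁ ℓ_{n'}^{−(d−2)})^{r+1}` one has
`c₂ ℓ_n^{2(d−1)} p_n(u_n) ≤ L_n^{−1}` for all `n ≥ 0`. -/
theorem renormalization_key_estimate (d : ℕ) (hd : 3 ≤ d) :
    ∃ c₁ c₂ : ℝ, 0 < c₁ ∧ 0 < c₂ ∧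
    ∃ c : ℕ, ∃ cL : ℕ → ℝ, (∀ L, 0 < cL L) ∧
    ∃ cLu : ℕ → ℝ → ℝ, (∀ L u, 0 < cLu L u) ∧
    ∀ L0 : ℕ, 1 < L0 → c ≤ L0 →
    ∀ u0 : ℝ, cL L0 ≤ u0 →
    ∀ r : ℕ, 1 ≤ r → cLu L0 u0 ≤ (r : ℝ) →
    ∀ (P : Zd d → Measure (ℕ → Zd d)), IsSRW d P →
    ∀ Q : ℕ → Measure (Zd d → Bool),
      (∀ n : ℕ, IsVacantLaw d P
        (u0 * ∏ k ∈ Finset.range n,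
          (1 + c₁ * ((ellScale d L0 k : ℝ) ^ (d - 2))⁻¹) ^ (r + 1))
        (Q n)) →
    ∀ (n : ℕ) (i : Zd d),
      c₂ * (ellScale d L0 n : ℝ) ^ (2 * (d - 1)) * ((Q n) (crossEvent d L0 n i)).toReal
        ≤ ((Lscale d L0 n : ℝ))⁻¹ := by
  classical
  have hdR : (3:ℝ) ≤ d := by exact_mod_cast hd
  set W : ℝ := (37 ^ d * 37 ^ d : ℝ) * 18 ^ (3 * d) with hW
  have hW1 : 1 ≤ W := by
    have h1 : (1:ℝ) ≤ 37 ^ d := one_le_pow₀ (by norm_num)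
    have h2 : (1:ℝ) ≤ 18 ^ (3 * d) := one_le_pow₀ (by norm_num)
    exact one_le_mul_of_one_le_of_one_le (one_le_mul_of_one_le_of_one_le h1 h1) h2
  have hlog : 0 ≤ Real.log W := Real.log_nonneg hW1
  have hdel := RK.del_pos
  have hu1 : 0 < 4 * Real.log W / RK.del + 1 := by positivity
  refine ⟨1, (100 ^ (2 * (d - 1)))⁻¹, one_pos, by positivity, 2,
    fun _ => 4 * Real.log W / RK.del + 1, fun _ => hu1, fun _ _ => 1, fun _ _ => one_pos, ?_⟩
  intro L0 hL0 _ u0 hu0 r _ _ P hP Q hQ n i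
  simp only [one_mul] at hQ
  have hprod : (1:ℝ) ≤ ∏ k ∈ Finset.range n, (1 + ((ellScale d L0 k : ℝ) ^ (d - 2))⁻¹) ^ (r + 1) := by
    apply Finset.prod_induction (p := fun x : ℝ => 1 ≤ x)
    · intro a b ha hb
      exact one_le_mul_of_one_le_of_one_le ha hb
    · exact le_rfl
    · intro k _
      apply one_le_pow₀
      have : 0 ≤ ((ellScale d L0 k : ℝ) ^ (d - 2))⁻¹ := by positivity
      linarith
  have hun : 4 * Real.log W / RK.del ≤
      u0 * ∏ k ∈ Finset.range n, (1 + ((ellScale d L0 k : ℝ) ^ (d - 2))⁻¹) ^ (r + 1) := by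
    nlinarith
  exact RK.final hd hP L0 hL0 _ hun _ (hQ n) n i
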